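/- Let n ≥ 1, let k ≥ 2, let ε ∈ (0,1), and let μ₁, …, μₙ be non-atomic Borel probability measures on [0,1]. Then there exist points 0 = t₀ ≤ t₁ ≤ … ≤ t_N = 1 with N ≤ n(k−1)·⌈2 + log₂(3k/ε)⌉ + 1 and an assignment of each subinterval [t_{j−1}, t_j] to one of k agents such that for every pair of agents a, b ∈ {1,…,k} and every measure i ∈ {1,…,n}, |μ_i(U_a) − μ_i(U_b)| ≤ 2ε/k, where U_a is the union of the subintervals assigned to agent a. -/

import Mathlib

open MeasureTheory Set

/-- A point of `κ → ℝ` is a simplex vertex if it is the indicator of a single coordinate. -/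
def IsVertex {κ : Type*} [DecidableEq κ] (x : κ → ℝ) : Prop := ∃ a, x = Pi.single a 1

noncomputable instance {κ : Type*} [DecidableEq κ] : DecidablePred (IsVertex (κ := κ)) :=
  Classical.decPred _

section Rounding

variable {I J κ : Type*} [DecidableEq J] [Fintype κ] [DecidableEq κ]

lemma isVertex_of_support_le {x y : κ → ℝ} (hx : IsVertex x) (hy : y ∈ stdSimplex ℝ κ)
    (h : ∀ a, x a = 0 → y a = 0) : y = x := by
  obtain ⟨a, rfl⟩ := hx
  have h0 : ∀ b, b ≠ a → y b = 0 := fun b hb => h b (by simp [hb])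
  have h1 : y a = 1 := by
    rw [← hy.2, Finset.sum_eq_single a (fun b _ hb => h0 b hb) (by simp)]
  ext b
  by_cases hb : b = a
  · subst hb; simp [h1]
  · simp [hb, h0 b hb]

lemma two_le_card_support {x : κ → ℝ} (hx : x ∈ stdSimplex ℝ κ) (h : ¬ IsVertex x) :
    2 ≤ (Finset.univ.filter fun a => x a ≠ 0).card := by
  by_contra! hlt
  have hle : (Finset.univ.filter fun a => x a ≠ 0).card ≤ 1 := by omega
  rw [Finset.card_le_one] at hle
  obtain ⟨a, ha⟩ : ∃ a, x a ≠ 0 := by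
    by_contra! h0
    have := hx.2
    simp [h0] at this
  refine h ⟨a, ?_⟩
  have h0 : ∀ b, b ≠ a → x b = 0 := by
    intro b hb
    by_contra hb0
    exact hb (hle b (by simp [hb0]) a (by simp [ha]))
  have h1 : x a = 1 := by
    rw [← hx.2, Finset.sum_eq_single a (fun b _ hb => h0 b hb) (by simp)]
  ext b
  by_cases hb : b = a
  · subst hb; simp [h1]
  · simp [hb, h0 b hb]

/-- A direction supported on the nonzero entries of `X` in the rows `A` that preserves row sums and
the weighted column sums, available as soon as there are many non-vertex rows. -/
lemma exists_balanced_direction [Nonempty κ] (A : Finset J) (S : Finset I) (v : I → J → ℝ)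
    (X : J → κ → ℝ) (hX : ∀ m, X m ∈ stdSimplex ℝ κ)
    (hF : S.card * (Fintype.card κ - 1) < {m ∈ A | ¬ IsVertex (X m)}.card) :
    ∃ y : J → κ → ℝ, (∃ m a, y m a ≠ 0) ∧ (∀ m a, y m a ≠ 0 → m ∈ A ∧ X m a ≠ 0) ∧
      (∀ m, ∑ a, y m a = 0) ∧ ∀ i ∈ S, ∀ a, ∑ m ∈ A, y m a * v i m = 0 := by
  classical
  obtain ⟨a₀⟩ := ‹Nonempty κ›
  set T : Finset J := A.filter fun m => ¬ IsVertex (X m) with hT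
  have hTc : S.card * (Fintype.card κ - 1) < T.card := hF
  set P : Finset (Σ _ : J, κ) := T.sigma fun m => Finset.univ.filter fun a => X m a ≠ 0 with hP
  have hPc : 2 * T.card ≤ P.card := by
    rw [hP, Finset.card_sigma, mul_comm, ← smul_eq_mul, ← Finset.sum_const]
    exact Finset.sum_le_sum fun m hm => two_le_card_support (hX m) (by simp_all)
  let E : (P → ℝ) →ₗ[ℝ] ((Σ _ : J, κ) → ℝ) := Function.ExtendByZero.linearMap ℝ Subtype.val
  let W : (T ⊕ S × {a // a ≠ a₀}) → ((Σ _ : J, κ) → ℝ) →ₗ[ℝ] ℝ :=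
    Sum.elim (fun m => ∑ a, LinearMap.proj ⟨m, a⟩)
      (fun q => ∑ m ∈ A, v q.1 m • LinearMap.proj ⟨m, q.2.1⟩)
  let L : (P → ℝ) →ₗ[ℝ] ((T ⊕ S × {a // a ≠ a₀}) → ℝ) := LinearMap.pi fun w => (W w).comp E
  have hker : LinearMap.ker L ≠ ⊥ := by
    apply LinearMap.ker_ne_bot_of_finrank_lt
    simp only [Module.finrank_fintype_fun_eq_card, Fintype.card_sum, Fintype.card_prod,
      Fintype.card_coe, Fintype.card_subtype_compl, Fintype.card_subtype_eq, ne_eq]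
    omega
  obtain ⟨z, hz, hz0⟩ := (Submodule.ne_bot_iff _).1 hker
  have hLz : ∀ w, W w (E z) = 0 := fun w => congrFun (LinearMap.mem_ker.1 hz) w
  have hEP : ∀ p : P, E z p = z p := fun p => Subtype.val_injective.extend_apply _ _ p
  have hE0 : ∀ p, p ∉ P → E z p = 0 := fun p hp => by
    refine Function.extend_apply' _ _ _ ?_
    rintro ⟨q, rfl⟩
    exact hp q.2
  have hsupp : ∀ m a, E z ⟨m, a⟩ ≠ 0 → m ∈ T ∧ X m a ≠ 0 := by
    intro m a h
    have : (⟨m, a⟩ : Σ _ : J, κ) ∈ P := by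
      by_contra hn
      exact h (hE0 _ hn)
    simpa [hP] using this
  have hrow : ∀ m, ∑ a, E z ⟨m, a⟩ = 0 := by
    intro m
    by_cases hm : m ∈ T
    · simpa [W] using hLz (Sum.inl ⟨m, hm⟩)
    · refine Finset.sum_eq_zero fun a _ => ?_
      by_contra h
      exact hm (hsupp m a h).1
  have hcol : ∀ i ∈ S, ∀ a, a ≠ a₀ → ∑ m ∈ A, E z ⟨m, a⟩ * v i m = 0 := by
    intro i hi a ha
    simpa [W, mul_comm] using hLz (Sum.inr ⟨⟨i, hi⟩, ⟨a, ha⟩⟩)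
  refine ⟨fun m a => E z ⟨m, a⟩, ?_, ?_, hrow, ?_⟩
  · obtain ⟨p, hp⟩ := Function.ne_iff.1 hz0
    exact ⟨p.1.1, p.1.2, fun h => hp ((hEP p).symm.trans h)⟩
  · intro m a h
    obtain ⟨h1, h2⟩ := hsupp m a h
    exact ⟨(Finset.mem_filter.1 h1).1, h2⟩
  · intro i hi a
    by_cases ha : a = a₀
    · subst ha
      have htot : ∑ b, ∑ m ∈ A, E z ⟨m, b⟩ * v i m = 0 := by
        rw [Finset.sum_comm]
        simp [← Finset.sum_mul, hrow]
      rwa [Finset.sum_eq_single a (fun b _ hb => hcol i hi b hb) (by simp)] at htot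
    · exact hcol i hi a ha

/-- Moving along a balanced direction until an entry vanishes. -/
lemma exists_smaller_support [Nonempty κ] (A : Finset J) (S : Finset I) (v : I → J → ℝ)
    (X : J → κ → ℝ) (hX : ∀ m, X m ∈ stdSimplex ℝ κ)
    (hF : S.card * (Fintype.card κ - 1) < {m ∈ A | ¬ IsVertex (X m)}.card) :
    ∃ X' : J → κ → ℝ, (∀ m, X' m ∈ stdSimplex ℝ κ) ∧ (∀ m a, X m a = 0 → X' m a = 0) ∧
      (∀ i ∈ S, ∀ a, ∑ m ∈ A, X' m a * v i m = ∑ m ∈ A, X m a * v i m) ∧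
      ((A ×ˢ Finset.univ).filter fun p : J × κ => X' p.1 p.2 ≠ 0).card <
        ((A ×ˢ Finset.univ).filter fun p : J × κ => X p.1 p.2 ≠ 0).card := by
  classical
  obtain ⟨y, ⟨m₀, a₀, hy0⟩, hsupp, hrow, hcol⟩ := exists_balanced_direction A S v X hX hF
  obtain ⟨a₁, ha₁⟩ : ∃ a, y m₀ a < 0 := by
    by_contra! h
    exact hy0 ((Finset.sum_eq_zero_iff_of_nonneg fun a _ => h a).1 (hrow m₀) a₀ (by simp))
  set Q : Finset (J × κ) := (A ×ˢ Finset.univ).filter fun p => y p.1 p.2 < 0 with hQ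
  have hQmem : ∀ m a, (m, a) ∈ Q ↔ y m a < 0 := by
    intro m a
    simp only [hQ, Finset.mem_filter, Finset.mem_product, Finset.mem_univ, and_true]
    exact ⟨fun h => h.2, fun h => ⟨(hsupp m a h.ne).1, h⟩⟩
  obtain ⟨⟨m₂, a₂⟩, hq, hmin⟩ := Q.exists_min_image (fun p => X p.1 p.2 / (-y p.1 p.2))
    ⟨(m₀, a₁), (hQmem _ _).2 ha₁⟩
  rw [hQmem] at hq
  set t : ℝ := X m₂ a₂ / (-y m₂ a₂) with ht
  have ht0 : 0 ≤ t := div_nonneg ((hX m₂).1 a₂) (by linarith)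
  have hzero : ∀ m a, X m a = 0 → X m a + t * y m a = 0 := by
    intro m a h
    have : y m a = 0 := by
      by_contra hne
      exact (hsupp m a hne).2 h
    simp [h, this]
  have hX2 : X m₂ a₂ + t * y m₂ a₂ = 0 := by
    rw [ht]
    field_simp [hq.ne]
    ring
  refine ⟨fun m a => X m a + t * y m a, fun m => ⟨fun a => ?_, ?_⟩, hzero, ?_, ?_⟩
  · rcases lt_or_ge (y m a) 0 with h | h
    · have h1 := hmin (m, a) ((hQmem _ _).2 h)
      simp only at h1
      rw [le_div_iff₀ (by linarith)] at h1
      linarith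
    · have := (hX m).1 a
      positivity
  · rw [Finset.sum_add_distrib, ← Finset.mul_sum, hrow, (hX m).2]
    simp
  · intro i hi a
    simp only [add_mul, Finset.sum_add_distrib, mul_assoc, ← Finset.mul_sum, hcol i hi a]
    simp
  · refine Finset.card_lt_card ((Finset.ssubset_iff_of_subset ?_).2 ⟨(m₂, a₂), ?_, ?_⟩)
    · intro p
      simp only [Finset.mem_filter]
      exact fun h => ⟨h.1, fun h0 => h.2 (hzero _ _ h0)⟩
    · simpa using hsupp _ _ hq.ne
    · simp [hX2]

/-- Basic solutions: few rows need to be split between several columns. -/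
lemma exists_few_fractional [Nonempty κ] (A : Finset J) (S : Finset I) (v : I → J → ℝ)
    (X : J → κ → ℝ) (hX : ∀ m, X m ∈ stdSimplex ℝ κ) :
    ∃ X' : J → κ → ℝ, (∀ m, X' m ∈ stdSimplex ℝ κ) ∧ (∀ m a, X m a = 0 → X' m a = 0) ∧
      (∀ i ∈ S, ∀ a, ∑ m ∈ A, X' m a * v i m = ∑ m ∈ A, X m a * v i m) ∧
      {m ∈ A | ¬ IsVertex (X' m)}.card ≤ S.card * (Fintype.card κ - 1) := by
  induction hs : ((A ×ˢ Finset.univ).filter fun p : J × κ => X p.1 p.2 ≠ 0).card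
    using Nat.strong_induction_on generalizing X with
  | _ s ih =>
    rcases le_or_gt {m ∈ A | ¬ IsVertex (X m)}.card (S.card * (Fintype.card κ - 1)) with h | h
    · exact ⟨X, hX, fun _ _ h => h, fun _ _ _ => rfl, h⟩
    · obtain ⟨X₁, h1, h2, h3, h4⟩ := exists_smaller_support A S v X hX h
      obtain ⟨X₂, g1, g2, g3, g4⟩ := ih _ (hs ▸ h4) X₁ h1 rfl
      exact ⟨X₂, g1, fun m a h => g2 m a (h2 m a h),
        fun i hi a => (g3 i hi a).trans (h3 i hi a), g4⟩

/-- Full rounding with an error bounded by the total weight of `Fintype.card κ - 1` rows. -/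
lemma exists_rounding [Nonempty κ] (A : Finset J) (v : I → J → ℝ) (S : Finset I)
    {δ : ℝ} (hδ0 : 0 ≤ δ)
    (hv : ∀ i ∈ S, ∀ m ∈ A, 0 ≤ v i m) (hδ : ∀ m ∈ A, ∑ i ∈ S, v i m ≤ δ)
    (X : J → κ → ℝ) (hX : ∀ m, X m ∈ stdSimplex ℝ κ) :
    ∃ X' : J → κ → ℝ, (∀ m, X' m ∈ stdSimplex ℝ κ) ∧ (∀ m a, X m a = 0 → X' m a = 0) ∧
      (∀ i ∈ S, ∀ a, |∑ m ∈ A, X' m a * v i m - ∑ m ∈ A, X m a * v i m| ≤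
        (Fintype.card κ - 1 : ℕ) * δ) ∧
      ∀ m ∈ A, IsVertex (X' m) := by
  classical
  induction hs : S.card generalizing S X with
  | zero =>
    obtain ⟨X', h1, h2, h3, h4⟩ := exists_few_fractional A S v X hX
    refine ⟨X', h1, h2, ?_, ?_⟩
    · rw [Finset.card_eq_zero] at hs
      simp [hs]
    · rw [hs, zero_mul, Nat.le_zero, Finset.card_eq_zero, Finset.filter_eq_empty_iff] at h4
      exact fun m hm => not_not.1 (h4 hm)
  | succ s ih =>
    obtain ⟨X₁, h1, h2, h3, h4⟩ := exists_few_fractional A S v X hX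
    set T : Finset J := A.filter fun m => ¬ IsVertex (X₁ m) with hT
    have hTc : T.card ≤ S.card * (Fintype.card κ - 1) := h4
    have hSne : S.Nonempty := Finset.card_pos.1 (by omega)
    obtain ⟨i₀, hi₀, hres⟩ : ∃ i ∈ S, ∑ m ∈ T, v i m ≤ (Fintype.card κ - 1 : ℕ) * δ := by
      refine Finset.exists_le_of_sum_le hSne ?_
      rw [Finset.sum_comm, Finset.sum_const, nsmul_eq_mul]
      have hδT : ∑ m ∈ T, ∑ i ∈ S, v i m ≤ T.card * δ := by
        rw [← nsmul_eq_mul, ← Finset.sum_const]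
        exact Finset.sum_le_sum fun m hm => hδ m (Finset.mem_filter.1 hm).1
      refine hδT.trans ?_
      rw [← mul_assoc]
      gcongr
      exact_mod_cast hTc
    have hsub : S.erase i₀ ⊆ S := Finset.erase_subset _ _
    obtain ⟨X₂, g1, g2, g3, g4⟩ := ih (S.erase i₀) (fun i hi => hv i (hsub hi))
      (fun m hm => (Finset.sum_le_sum_of_subset_of_nonneg hsub
        fun i hi _ => hv i hi m hm).trans (hδ m hm)) X₁ h1 (by
        rw [Finset.card_erase_of_mem hi₀]; omega)
    refine ⟨X₂, g1, fun m a h => g2 m a (h2 m a h), fun i hi a => ?_, g4⟩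
    rw [← h3 i hi a]
    by_cases hii : i = i₀
    · subst hii
      refine le_trans ?_ hres
      rw [← Finset.sum_sub_distrib, hT, Finset.sum_filter]
      simp only [ite_not]
      refine (Finset.abs_sum_le_sum_abs _ _).trans (Finset.sum_le_sum fun m hm => ?_)
      split_ifs with hvert
      · rw [isVertex_of_support_le hvert (g1 m) (g2 m)]
        simp
      · rw [← sub_mul, abs_mul, abs_of_nonneg (hv i hi m hm)]
        refine mul_le_of_le_one_left (hv i hi m hm) ?_
        have b1 := (mem_Icc_of_mem_stdSimplex (h1 m) a)
        have b2 := (mem_Icc_of_mem_stdSimplex (g1 m) a)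
        rw [abs_le]
        constructor <;> linarith [b1.1, b1.2, b2.1, b2.2]
    · exact g3 i (Finset.mem_erase.2 ⟨hii, hi⟩) a

end Rounding

lemma sum_range_two_mul (g : ℕ → ℝ) (M : ℕ) :
    ∑ m ∈ Finset.range (2 * M), g m = ∑ m ∈ Finset.range M, (g (2 * m) + g (2 * m + 1)) := by
  induction M with
  | zero => simp
  | succ M ih =>
    rw [Finset.sum_range_succ, ← ih, show 2 * (M + 1) = 2 * M + 1 + 1 by ring,
      Finset.sum_range_succ, Finset.sum_range_succ]
    ring

section Refinement

variable {I κ : Type*} [DecidableEq κ]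

/-- The boundary between the cells `m` and `m + 1` is a genuine cut of the fractional assignment `X`
unless both cells go entirely to the same agent. -/
def IsCut (X : ℕ → κ → ℝ) (m : ℕ) : Prop := ¬ (IsVertex (X m) ∧ X (m + 1) = X m)

noncomputable instance (X : ℕ → κ → ℝ) : DecidablePred (IsCut X) := Classical.decPred _

lemma card_isCut_div_two_le (X : ℕ → κ → ℝ) (M : ℕ) :
    {m ∈ Finset.range (2 * M - 1) | IsCut (fun m => X (m / 2)) m}.card ≤
      {m ∈ Finset.range (M - 1) | IsCut X m}.card +
        {m ∈ Finset.range M | ¬ IsVertex (X m)}.card := by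
  classical
  have hsub : {m ∈ Finset.range (2 * M - 1) | IsCut (fun m => X (m / 2)) m} ⊆
      ({m ∈ Finset.range (M - 1) | IsCut X m}.image fun m => 2 * m + 1) ∪
        ({m ∈ Finset.range M | ¬ IsVertex (X m)}.image fun m => 2 * m) := by
    intro m hm
    simp only [Finset.mem_filter, Finset.mem_range, Finset.mem_union, Finset.mem_image] at hm ⊢
    obtain ⟨hlt, hcut⟩ := hm
    rcases Nat.even_or_odd' m with ⟨l, rfl | rfl⟩
    · refine Or.inr ⟨l, ⟨by omega, fun hv => hcut ⟨?_, ?_⟩⟩, rfl⟩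
      · simpa using hv
      · simp only
        congr 1
        omega
    · refine Or.inl ⟨l, ⟨by omega, fun hv => hcut ?_⟩, rfl⟩
      have h1 : (2 * l + 1) / 2 = l := by omega
      have h2 : (2 * l + 1 + 1) / 2 = l + 1 := by omega
      simpa only [h1, h2] using hv
  exact (Finset.card_le_card hsub).trans ((Finset.card_union_le _ _).trans
    (add_le_add Finset.card_image_le Finset.card_image_le))

variable [Fintype κ]

lemma IsCut.of_support_le {X X' : ℕ → κ → ℝ} (hX' : ∀ m, X' m ∈ stdSimplex ℝ κ)
    (h : ∀ m a, X m a = 0 → X' m a = 0) {m : ℕ} (hm : IsCut X' m) : IsCut X m := by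
  rintro ⟨hv, heq⟩
  have h1 := isVertex_of_support_le hv (hX' m) (h m)
  have h2 := isVertex_of_support_le (heq.symm ▸ hv) (hX' (m + 1)) (h (m + 1))
  exact hm ⟨h1.symm ▸ hv, by rw [h1, h2, heq]⟩

/-- Repeatedly halving all cells and passing to a basic solution. -/
lemma exists_fractional_assignment [Nonempty κ] [Fintype I] (w : ℕ → I → ℕ → ℝ)
    (hw : ∀ r i m, w r i m = w (r + 1) i (2 * m) + w (r + 1) i (2 * m + 1))
    {D : ℕ} (hD : Fintype.card I * (Fintype.card κ - 1) ≤ D) (hD1 : 1 ≤ D)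
    (X₀ : ℕ → κ → ℝ) (hX₀ : ∀ m, X₀ m ∈ stdSimplex ℝ κ) (r : ℕ) :
    ∃ X : ℕ → κ → ℝ, (∀ m, X m ∈ stdSimplex ℝ κ) ∧
      (∀ i a, ∑ m ∈ Finset.range (2 ^ r * D), X m a * w r i m =
        ∑ m ∈ Finset.range D, X₀ m a * w 0 i m) ∧
      {m ∈ Finset.range (2 ^ r * D) | ¬ IsVertex (X m)}.card ≤ D ∧
      {m ∈ Finset.range (2 ^ r * D - 1) | IsCut X m}.card + 1 ≤ D * (r + 1) := by
  induction r with
  | zero =>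
    refine ⟨X₀, hX₀, by simp, ?_, ?_⟩
    · exact (Finset.card_filter_le _ _).trans (by simp)
    · have := Finset.card_filter_le (Finset.range (2 ^ 0 * D - 1)) fun m => IsCut X₀ m
      simp only [Finset.card_range, pow_zero, one_mul] at this ⊢
      omega
  | succ r ih =>
    obtain ⟨X, h1, h2, h3, h4⟩ := ih
    obtain ⟨X', g1, g2, g3, g4⟩ := exists_few_fractional (Finset.range (2 ^ (r + 1) * D))
      Finset.univ (w (r + 1)) (fun m => X (m / 2)) (fun m => h1 _)
    have hM : 2 ^ (r + 1) * D = 2 * (2 ^ r * D) := by ring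
    refine ⟨X', g1, fun i a => ?_, g4.trans hD, ?_⟩
    · rw [g3 i (Finset.mem_univ i) a, ← h2, hM, sum_range_two_mul]
      refine Finset.sum_congr rfl fun m _ => ?_
      have e1 : 2 * m / 2 = m := by omega
      have e2 : (2 * m + 1) / 2 = m := by omega
      rw [e1, e2, hw r i m]
      ring
    · have hle : {m ∈ Finset.range (2 ^ (r + 1) * D - 1) | IsCut X' m}.card ≤
          {m ∈ Finset.range (2 ^ (r + 1) * D - 1) | IsCut (fun m => X (m / 2)) m}.card :=
        Finset.card_le_card (Finset.monotone_filter_right _ fun m _ hm => hm.of_support_le g1 g2)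
      have hle' := card_isCut_div_two_le X (2 ^ r * D)
      rw [← hM] at hle'
      calc _ ≤ D * (r + 1) + D := by omega
        _ = D * (r + 1 + 1) := by ring

/-- A colouring of the finest cells with few colour changes that approximates the prescribed
fractional assignment. -/
lemma exists_coloring [Nonempty κ] [Fintype I] (w : ℕ → I → ℕ → ℝ)
    (hw : ∀ r i m, w r i m = w (r + 1) i (2 * m) + w (r + 1) i (2 * m + 1))
    {D : ℕ} (hD : Fintype.card I * (Fintype.card κ - 1) ≤ D) (hD1 : 1 ≤ D)
    (X₀ : ℕ → κ → ℝ) (hX₀ : ∀ m, X₀ m ∈ stdSimplex ℝ κ) (r : ℕ) {δ : ℝ} (hδ0 : 0 ≤ δ)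
    (hpos : ∀ i, ∀ m < 2 ^ r * D, 0 ≤ w r i m) (hδ : ∀ m < 2 ^ r * D, ∑ i, w r i m ≤ δ) :
    ∃ c : ℕ → κ,
      {m ∈ Finset.range (2 ^ r * D - 1) | c (m + 1) ≠ c m}.card + 1 ≤ D * (r + 1) ∧
      ∀ i a, |∑ m ∈ Finset.range (2 ^ r * D) with c m = a, w r i m -
        ∑ m ∈ Finset.range D, X₀ m a * w 0 i m| ≤ (Fintype.card κ - 1 : ℕ) * δ := by
  obtain ⟨X, h1, h2, -, h4⟩ := exists_fractional_assignment w hw hD hD1 X₀ hX₀ r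
  obtain ⟨X', g1, g2, g3, g4⟩ := exists_rounding (Finset.range (2 ^ r * D)) (w r) Finset.univ hδ0
    (fun i _ m hm => hpos i m (Finset.mem_range.1 hm)) (fun m hm => hδ m (Finset.mem_range.1 hm))
    X h1
  have hc : ∀ m, ∃ a, m < 2 ^ r * D → X' m = Pi.single a 1 := by
    intro m
    by_cases hm : m < 2 ^ r * D
    · obtain ⟨a, ha⟩ := g4 m (Finset.mem_range.2 hm)
      exact ⟨a, fun _ => ha⟩
    · exact ⟨Classical.arbitrary κ, fun h => absurd h hm⟩
  choose c hc using hc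
  refine ⟨c, le_trans ?_ h4, fun i a => ?_⟩
  · gcongr 1
    refine Finset.card_le_card fun m hm => ?_
    simp only [Finset.mem_filter, Finset.mem_range] at hm ⊢
    refine ⟨hm.1, IsCut.of_support_le g1 g2 fun hv => hm.2 ?_⟩
    have heq := hv.2
    rw [hc m (by omega), hc (m + 1) (by omega)] at heq
    by_contra hne
    have := congrFun heq (c (m + 1))
    simp [hne] at this
  · rw [← h2 i a, Finset.sum_filter]
    convert g3 i (Finset.mem_univ i) a using 3
    refine Finset.sum_congr rfl fun m hm => ?_
    rw [hc m (Finset.mem_range.1 hm)]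
    by_cases h : c m = a
    · subst h; simp
    · simp [h, Ne.symm h]

end Refinement

/-- Merging neighbouring cells of the same colour. -/
lemma exists_merged_pieces {κ : Type*} [DecidableEq κ] (q : ℕ → ℝ) (c : ℕ → κ) (M : ℕ)
    (hq : ∀ m ≤ M, q m ≤ q (m + 1)) :
    ∃ (N : ℕ) (t : ℕ → ℝ) (f : ℕ → κ), N ≤ {m ∈ Finset.range M | c (m + 1) ≠ c m}.card ∧
      t 0 = q 0 ∧ t (N + 1) = q (M + 1) ∧ (∀ j ≤ N, t j ≤ t (j + 1)) ∧ f N = c M ∧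
      ∀ a x, (∃ j ≤ N, f j = a ∧ t j ≤ x ∧ x ≤ t (j + 1)) ↔
        ∃ m ≤ M, c m = a ∧ q m ≤ x ∧ x ≤ q (m + 1) := by
  induction M with
  | zero => exact ⟨0, q, c, by simp, rfl, rfl, hq, rfl, fun a x => Iff.rfl⟩
  | succ M ih =>
    obtain ⟨N, t, f, hN, h0, hl, hm, hf, hU⟩ := ih fun m hm => hq m (by omega)
    have hqM := hq (M + 1) le_rfl
    have hsplit : ∀ a x, (∃ m ≤ M + 1, c m = a ∧ q m ≤ x ∧ x ≤ q (m + 1)) ↔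
        (∃ j ≤ N, f j = a ∧ t j ≤ x ∧ x ≤ t (j + 1)) ∨
          (c (M + 1) = a ∧ q (M + 1) ≤ x ∧ x ≤ q (M + 1 + 1)) := by
      intro a x
      rw [hU]
      constructor
      · rintro ⟨m, hm, h⟩
        rcases Nat.le_succ_iff.1 hm with hm | rfl
        · exact Or.inl ⟨m, hm, h⟩
        · exact Or.inr h
      · rintro (⟨m, hm, h⟩ | h)
        · exact ⟨m, by omega, h⟩
        · exact ⟨M + 1, le_rfl, h⟩
    simp only [hsplit]
    rw [Finset.range_add_one, Finset.filter_insert]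
    by_cases hc : c (M + 1) = c M
    · have ht : ∀ j ≤ N, Function.update t (N + 1) (q (M + 1 + 1)) j = t j := fun j hj =>
        Function.update_of_ne (by omega) _ _
      have ht' : Function.update t (N + 1) (q (M + 1 + 1)) (N + 1) = q (M + 1 + 1) := by simp
      have hNN : t N ≤ q (M + 1) := hl ▸ hm N le_rfl
      refine ⟨N, Function.update t (N + 1) (q (M + 1 + 1)), f, by simpa [hc] using hN,
        by rw [ht 0 (by omega), h0], ht', fun j hj => ?_, by rw [hf, hc], fun a x => ?_⟩
      · rw [ht j hj]
        rcases hj.lt_or_eq with hj | rfl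
        · rw [ht (j + 1) hj]
          exact hm j hj.le
        · rw [ht']
          linarith
      · constructor
        · rintro ⟨j, hj, h1, h2, h3⟩
          rw [ht j hj] at h2
          rcases hj.lt_or_eq with hj' | rfl
          · rw [ht (j + 1) hj'] at h3
            exact Or.inl ⟨j, hj, h1, h2, h3⟩
          · rw [ht'] at h3
            rcases le_total x (q (M + 1)) with hx | hx
            · exact Or.inl ⟨j, le_rfl, h1, h2, hl ▸ hx⟩
            · exact Or.inr ⟨by rw [hc, ← hf, h1], hx, h3⟩
        · rintro (⟨j, hj, h1, h2, h3⟩ | ⟨h1, h2, h3⟩)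
          · refine ⟨j, hj, h1, by rwa [ht j hj], ?_⟩
            rcases hj.lt_or_eq with hj' | rfl
            · rwa [ht (j + 1) hj']
            · rw [ht']
              linarith
          · exact ⟨N, le_rfl, by rw [hf, ← hc, h1], by rw [ht N le_rfl]; linarith, by rwa [ht']⟩
    · have ht : ∀ j ≤ N + 1, Function.update t (N + 2) (q (M + 1 + 1)) j = t j := fun j hj =>
        Function.update_of_ne (by omega) _ _
      have ht' : Function.update t (N + 2) (q (M + 1 + 1)) (N + 1 + 1) = q (M + 1 + 1) := by simp
      have hf1 : ∀ j ≤ N, Function.update f (N + 1) (c (M + 1)) j = f j := fun j hj =>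
        Function.update_of_ne (by omega) _ _
      have hf2 : Function.update f (N + 1) (c (M + 1)) (N + 1) = c (M + 1) := by simp
      refine ⟨N + 1, Function.update t (N + 2) (q (M + 1 + 1)),
        Function.update f (N + 1) (c (M + 1)), by simpa [hc] using hN,
        by rw [ht 0 (by omega), h0], ht', fun j hj => ?_, hf2, fun a x => ?_⟩
      · rw [ht j hj]
        rcases hj.lt_or_eq with hj | rfl
        · rw [ht (j + 1) hj]
          exact hm j (by omega)
        · rw [ht', hl]
          exact hqM
      · constructor
        · rintro ⟨j, hj, h1, h2, h3⟩
          rw [ht j hj] at h2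
          rcases hj.lt_or_eq with hj' | rfl
          · rw [ht (j + 1) hj'] at h3
            rw [hf1 j (by omega)] at h1
            exact Or.inl ⟨j, by omega, h1, h2, h3⟩
          · rw [ht'] at h3
            rw [hf2] at h1
            exact Or.inr ⟨h1, hl ▸ h2, h3⟩
        · rintro (⟨j, hj, h1, h2, h3⟩ | ⟨h1, h2, h3⟩)
          · exact ⟨j, by omega, by rwa [hf1 j hj], by rwa [ht j (by omega)],
              by rwa [ht (j + 1) (by omega)]⟩
          · exact ⟨N + 1, le_rfl, by rwa [hf2], by rwa [ht _ le_rfl, hl], by rwa [ht']⟩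

lemma continuous_cdf (μ : Measure ℝ) [IsProbabilityMeasure μ] [NullSingletonClass μ] :
    Continuous (ProbabilityTheory.cdf μ) := by
  refine continuous_iff_continuousAt.2 fun x => ?_
  have hmono := ProbabilityTheory.monotone_cdf μ
  rw [hmono.continuousAt_iff_leftLim_eq_rightLim, StieltjesFunction.rightLim_eq]
  have h := (ProbabilityTheory.cdf μ).measure_singleton x
  rw [ProbabilityTheory.measure_cdf, measure_singleton, eq_comm, ENNReal.ofReal_eq_zero] at h
  exact le_antisymm (hmono.leftLim_le le_rfl) (by linarith)

lemma cdf_sub_cdf_eq_measureReal_Icc (μ : Measure ℝ) [IsProbabilityMeasure μ] [NullSingletonClass μ]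
    {x y : ℝ} (hxy : x ≤ y) :
    ProbabilityTheory.cdf μ y - ProbabilityTheory.cdf μ x = μ.real (Icc x y) := by
  rw [← measureReal_congr (Ioc_ae_eq_Icc (μ := μ)), measureReal_def,
    ← ENNReal.toReal_ofReal (sub_nonneg.2 (ProbabilityTheory.monotone_cdf μ hxy)),
    ← StieltjesFunction.measure_Ioc, ProbabilityTheory.measure_cdf]

lemma exists_quantile {G : ℝ → ℝ} (hG : Continuous G) {L : ℝ} (hL : 0 < L) (h0 : G 0 = 0)
    (h1 : G 1 = L) :
    ∃ q : ℝ → ℝ, q 0 = 0 ∧ q L = 1 ∧ ∀ s ∈ Icc 0 L, G (q s) = s := by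
  have hex : ∀ s, ∃ x, (s = 0 → x = 0) ∧ (s = L → x = 1) ∧ (s ∈ Icc 0 L → G x = s) := by
    intro s
    by_cases hs0 : s = 0
    · exact ⟨0, fun _ => rfl, fun h => by linarith, fun _ => by rw [h0, hs0]⟩
    by_cases hsL : s = L
    · exact ⟨1, fun h => absurd h hs0, fun _ => rfl, fun _ => by rw [h1, hsL]⟩
    by_cases hs : s ∈ Icc 0 L
    · obtain ⟨x, -, hx⟩ := intermediate_value_Icc zero_le_one hG.continuousOn
        (show s ∈ Icc (G 0) (G 1) by rwa [h0, h1])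
      exact ⟨x, fun h => absurd h hs0, fun h => absurd h hsL, fun _ => hx⟩
    · exact ⟨0, fun h => absurd h hs0, fun h => absurd h hsL, fun h => absurd h hs⟩
  choose q hq using hex
  exact ⟨q, (hq 0).1 rfl, (hq L).2.1 rfl, fun s hs => (hq s).2.2 hs⟩

lemma measureReal_biUnion_Icc (μ : Measure ℝ) [IsProbabilityMeasure μ] [NullSingletonClass μ]
    {q : ℕ → ℝ}
    {M : ℕ} (hq : ∀ m m' : ℕ, m ≤ m' → m' ≤ M → q m ≤ q m') (s : Finset ℕ) (hs : ∀ m ∈ s, m < M) :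
    μ.real (⋃ m ∈ s, Icc (q m) (q (m + 1))) =
      ∑ m ∈ s, (ProbabilityTheory.cdf μ (q (m + 1)) - ProbabilityTheory.cdf μ (q m)) := by
  have hdisj : ∀ m m' : ℕ, m < m' → m' ∈ s →
      AEDisjoint μ (Icc (q m) (q (m + 1))) (Icc (q m') (q (m' + 1))) := by
    intro m m' hlt hm'
    refine measure_mono_null (t := {q m'}) ?_ (measure_singleton _)
    rintro x ⟨⟨-, hx1⟩, hx2, -⟩
    exact le_antisymm (hx1.trans (hq _ _ hlt (hs m' hm').le)) hx2
  rw [measureReal_biUnion_finset₀]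
  · exact Finset.sum_congr rfl fun m hm =>
      (cdf_sub_cdf_eq_measureReal_Icc μ (hq _ _ (Nat.le_succ m) (hs m hm))).symm
  · intro m hm m' hm' hne
    rcases lt_or_gt_of_ne hne with h | h
    · exact hdisj m m' h hm'
    · exact (hdisj m' m h hm).symm
  · exact fun _ _ => measurableSet_Icc.nullMeasurableSet

/-- Consensus splitting with discrepancy `2 / 2 ^ r` and at most `n (k - 1) (r + 1)` pieces. -/
lemma exists_consensus_splitting (n k : ℕ) (hn : 1 ≤ n) (hk : 2 ≤ k) (μ : Fin n → Measure ℝ)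
    (hprob : ∀ i, IsProbabilityMeasure (μ i)) (hsupp : ∀ i, μ i (Icc (0 : ℝ) 1) = 1)
    (hna : ∀ i, NullSingletonClass (μ i)) (r : ℕ) :
    ∃ N : ℕ, N ≤ n * (k - 1) * (r + 1) ∧
      ∃ t : Fin (N + 1) → ℝ, Monotone t ∧ t 0 = 0 ∧ t (Fin.last N) = 1 ∧
        ∃ f : Fin N → Fin k, ∀ (a b : Fin k) (i : Fin n),
          |(μ i).real (⋃ j ∈ {j : Fin N | f j = a}, Icc (t j.castSucc) (t j.succ)) -
            (μ i).real (⋃ j ∈ {j : Fin N | f j = b}, Icc (t j.castSucc) (t j.succ))|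
            ≤ 2 / 2 ^ r := by
  have hkR : (0 : ℝ) < (k - 1 : ℕ) := by exact_mod_cast (by omega : 0 < k - 1)
  have hnR : (0 : ℝ) < n := by exact_mod_cast hn
  have : Nonempty (Fin k) := ⟨⟨0, by omega⟩⟩
  let F : Fin n → ℝ → ℝ := fun i => ProbabilityTheory.cdf (μ i)
  have hFmono : ∀ i, Monotone (F i) := fun i => ProbabilityTheory.monotone_cdf (μ i)
  have hF1 : ∀ i, F i 1 = 1 := fun i => by
    refine le_antisymm (ProbabilityTheory.cdf_le_one _ _) ?_
    have h : (μ i).real (Icc 0 1) = 1 := by simp [measureReal_def, hsupp]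
    refine h.symm.trans_le ?_
    exact (measureReal_mono Icc_subset_Iic_self).trans (ProbabilityTheory.cdf_eq_real _ _).ge
  have hF0 : ∀ i, F i 0 = 0 := fun i => by
    have h : (μ i).real (Icc 0 1) = 1 := by simp [measureReal_def, hsupp]
    rw [← cdf_sub_cdf_eq_measureReal_Icc (μ i) zero_le_one] at h
    have := hF1 i
    simp only [F] at this ⊢
    linarith
  obtain ⟨q, hq0, hq1, hq⟩ := exists_quantile (G := fun x => ∑ i, F i x)
    (continuous_finsetSum _ fun i _ => continuous_cdf (μ i)) hnR (by simp [hF0]) (by simp [hF1])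
  have hqmono : ∀ s s' : ℝ, 0 ≤ s → s ≤ s' → s' ≤ n → q s ≤ q s' := by
    intro s s' h0 hss h1
    by_contra! hlt
    have h2 : ∑ i, F i (q s') ≤ ∑ i, F i (q s) := Finset.sum_le_sum fun i _ => hFmono i hlt.le
    have e1 : ∑ i, F i (q s) = s := hq s ⟨h0, hss.trans h1⟩
    have e2 : ∑ i, F i (q s') = s' := hq s' ⟨h0.trans hss, h1⟩
    have : s = s' := le_antisymm hss (by linarith)
    rw [this] at hlt
    exact lt_irrefl _ hlt
  set D := n * (k - 1) with hD
  have hD1 : 1 ≤ D := Nat.mul_pos hn (by omega)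
  let h : ℕ → ℝ := fun r => ((k - 1 : ℕ) : ℝ)⁻¹ / 2 ^ r
  have hh : ∀ r, 0 ≤ h r := fun r => by positivity
  have hM : ((2 ^ r * D : ℕ) : ℝ) * h r = n := by
    simp only [h, hD]
    push_cast
    field_simp
  let w : ℕ → Fin n → ℕ → ℝ := fun r i m =>
    F i (q ((m + 1 : ℕ) * h r)) - F i (q ((m : ℕ) * h r))
  have hw : ∀ r i m, w r i m = w (r + 1) i (2 * m) + w (r + 1) i (2 * m + 1) := by
    intro r i m
    have e : ∀ l : ℕ, ((2 * l : ℕ) : ℝ) * h (r + 1) = l * h r := by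
      intro l
      simp only [h]
      push_cast
      field_simp
      ring
    simp only [w]
    rw [show 2 * m + 1 + 1 = 2 * (m + 1) by ring, e, e]
    ring
  have hle : ∀ m ≤ 2 ^ r * D, (m : ℝ) * h r ≤ n := by
    intro m hm
    rw [← hM]
    exact mul_le_mul_of_nonneg_right (by exact_mod_cast hm) (hh r)
  have hQ : ∀ m m' : ℕ, m ≤ m' → m' ≤ 2 ^ r * D → q (m * h r) ≤ q (m' * h r) :=
    fun m m' hmm hm' => hqmono _ _ (mul_nonneg m.cast_nonneg (hh r))
      (mul_le_mul_of_nonneg_right (by exact_mod_cast hmm) (hh r)) (hle m' hm')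
  have hsum : ∀ m ≤ 2 ^ r * D, ∑ i, F i (q (m * h r)) = m * h r := fun m hm =>
    hq _ ⟨mul_nonneg m.cast_nonneg (hh r), hle m hm⟩
  obtain ⟨c, hc, herr⟩ := exists_coloring (κ := Fin k) w hw (D := D) (by simp [hD]) hD1
    (fun _ _ => (k : ℝ)⁻¹)
    (fun _ => ⟨fun _ => by positivity, by simp [show k ≠ 0 by omega]⟩) r (hh r)
    (fun i m hm => sub_nonneg.2 (hFmono i (hQ _ _ (Nat.le_succ m) hm)))
    (fun m hm => by
      simp only [w]
      rw [Finset.sum_sub_distrib, hsum _ hm, hsum _ hm.le]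
      push_cast
      linarith)
  obtain ⟨M, hMM⟩ : ∃ M, 2 ^ r * D = M + 1 :=
    Nat.exists_eq_succ_of_ne_zero (Nat.mul_pos (by positivity) hD1).ne'
  obtain ⟨N, t, f, hN, ht0, ht1, htm, -, hU⟩ := exists_merged_pieces (fun m : ℕ => q (m * h r)) c M
    fun m hm => hQ _ _ (Nat.le_succ m) (by omega)
  rw [hMM] at hc herr hM hQ
  have hset : ∀ a : Fin k, (⋃ j ∈ {j : Fin (N + 1) | f j = a}, Icc (t j) (t (j + 1))) =
      ⋃ m ∈ (Finset.range (M + 1)).filter fun m => c m = a,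
        Icc (q ((m : ℕ) * h r)) (q ((m + 1 : ℕ) * h r)) := by
    intro a
    ext x
    simp only [mem_iUnion, mem_ofPred_eq, Finset.mem_filter, Finset.mem_range, mem_Icc, exists_prop,
      Nat.lt_succ_iff, and_assoc]
    rw [← hU a x]
    exact ⟨fun ⟨j, hj⟩ => ⟨j, Nat.lt_succ_iff.1 j.2, hj⟩,
      fun ⟨j, hj, hx⟩ => ⟨⟨j, Nat.lt_succ_iff.2 hj⟩, hx⟩⟩
  refine ⟨N + 1, by simpa using (Nat.succ_le_succ hN).trans hc, fun j => t j,
    Fin.monotone_iff_le_succ.2 fun j => htm j (Nat.lt_succ_iff.1 j.2), ?_, ?_, fun j => f j,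
    fun a b i => ?_⟩
  · simp [ht0, hq0]
  · exact ht1.trans ((congrArg q hM).trans hq1)
  · have hmeas : ∀ a, (μ i).real (⋃ j ∈ {j : Fin (N + 1) | f j = a}, Icc (t j) (t (j + 1))) =
        ∑ m ∈ Finset.range (M + 1) with c m = a, w r i m := fun a => by
      rw [hset]
      exact measureReal_biUnion_Icc (μ i) (q := fun m : ℕ => q (m * h r)) hQ _ fun m hm =>
        Finset.mem_range.1 (Finset.mem_filter.1 hm).1
    simp only [Fin.val_castSucc, Fin.val_succ, hmeas]
    have ha := abs_le.1 (herr i a)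
    have hb := abs_le.1 (herr i b)
    have hδ : ((Fintype.card (Fin k) - 1 : ℕ) : ℝ) * h r = 1 / 2 ^ r := by
      simp only [h, Fintype.card_fin]
      field_simp
    rw [hδ] at ha hb
    have h2 : (2 : ℝ) / 2 ^ r = 1 / 2 ^ r + 1 / 2 ^ r := by ring
    rw [h2, abs_le]
    constructor <;> linarith [ha.1, ha.2, hb.1, hb.2]

/-- Offline ε-Consensus Splitting with `k` agents: at most `n(k−1)⌈2 + log₂(3k/ε)⌉` cuts
suffice to split `[0,1]` among `k` agents with absolute discrepancy at most `2ε/k`. -/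
theorem offline_consensus_splitting
    (n k : ℕ) (hn : 1 ≤ n) (hk : 2 ≤ k) (ε : ℝ) (hε : ε ∈ Set.Ioo (0 : ℝ) 1)
    (μ : Fin n → Measure ℝ)
    (hprob : ∀ i, IsProbabilityMeasure (μ i))
    (hsupp : ∀ i, μ i (Set.Icc (0 : ℝ) 1) = 1)
    (hna : ∀ i (x : ℝ), μ i {x} = 0) :
    ∃ N : ℕ, (N : ℤ) ≤ (n : ℤ) * ((k : ℤ) - 1) * ⌈(2 + Real.logb 2 (3 * k / ε) : ℝ)⌉ + 1 ∧
      ∃ t : Fin (N + 1) → ℝ, Monotone t ∧ t 0 = 0 ∧ t (Fin.last N) = 1 ∧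
        ∃ f : Fin N → Fin k,
          ∀ (a b : Fin k) (i : Fin n),
            |(μ i (⋃ j ∈ {j : Fin N | f j = a}, Set.Icc (t j.castSucc) (t j.succ))).toReal -
             (μ i (⋃ j ∈ {j : Fin N | f j = b}, Set.Icc (t j.castSucc) (t j.succ))).toReal|
              ≤ 2 * ε / k := by
  have hkR : (0 : ℝ) < k := by exact_mod_cast (by omega : 0 < k)
  have hpos : (0 : ℝ) < 3 * k / ε := div_pos (by positivity) hε.1
  have hlog : 0 ≤ Real.logb 2 (3 * k / ε) := by
    refine Real.logb_nonneg one_lt_two ((one_le_div hε.1).2 ?_)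
    have : (2 : ℝ) ≤ k := by exact_mod_cast hk
    linarith [hε.2]
  set C : ℤ := ⌈(2 + Real.logb 2 (3 * k / ε) : ℝ)⌉ with hC
  have hCle : 2 + Real.logb 2 (3 * k / ε) ≤ C := Int.le_ceil _
  have hC1 : 1 ≤ C := by
    have : (1 : ℝ) ≤ C := by linarith
    exact_mod_cast this
  obtain ⟨r, hr⟩ := Int.eq_ofNat_of_zero_le (sub_nonneg.2 hC1)
  have hpow : 3 * k / ε ≤ 2 ^ r := by
    have hrR : (C : ℝ) - 1 = r := by exact_mod_cast hr
    rw [← Real.rpow_natCast, ← Real.logb_le_iff_le_rpow one_lt_two hpos]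
    linarith
  obtain ⟨N, hN, t, ht, h0, h1, f, hf⟩ :=
    exists_consensus_splitting n k hn hk μ hprob hsupp (fun i => ⟨hna i⟩) r
  refine ⟨N, ?_, t, ht, h0, h1, f, fun a b i => (hf a b i).trans ?_⟩
  · have hNZ : (N : ℤ) ≤ (n * (k - 1) * (r + 1) : ℕ) := by exact_mod_cast hN
    push_cast [Nat.cast_sub (by omega : 1 ≤ k)] at hNZ
    rw [show C = r + 1 by omega]
    linarith
  · rw [div_le_iff₀ hε.1] at hpow
    rw [div_le_div_iff₀ (by positivity) hkR]
    linarith
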